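/- Let α1, α2 ∈ K with 3α1−α2 ≠ 0. In D_3(α1,α2) define e1 = (3α1−α2)⁻¹·((b+c)² − (α1+α2)), e2 = (3α1−α2)⁻¹·((a+c)² − (α1+α2)), e3 = (3α1−α2)⁻¹·((a+b)² − (α1+α2)). Then e1, e2, e3 are idempotents, they lie in the center of D_3(α1,α2), they are pairwise orthogonal (e_i·e_j = 0 for i ≠ j), and e1 + e2 + e3 = 1. -/

import Mathlib

noncomputable section

open FreeAlgebra

/-- The defining relations of the PBW deformation `D₃(α₁, α₂)` of the Fomin–Kirillov
algebra `E₃`: with generators `a = ι K 0`, `b = ι K 1`, `c = ι K 2`, the relations are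
`a² = b² = c² = α₁`, `ca + bc + ab = α₂` and `cb + ba + ac = α₂`. -/
inductive D3Rel (K : Type) [Field K] (α1 α2 : K) :
    FreeAlgebra K (Fin 3) → FreeAlgebra K (Fin 3) → Prop
  | ra : D3Rel K α1 α2 (ι K (0 : Fin 3) * ι K (0 : Fin 3))
      (algebraMap K (FreeAlgebra K (Fin 3)) α1)
  | rb : D3Rel K α1 α2 (ι K (1 : Fin 3) * ι K (1 : Fin 3))
      (algebraMap K (FreeAlgebra K (Fin 3)) α1)
  | rc : D3Rel K α1 α2 (ι K (2 : Fin 3) * ι K (2 : Fin 3))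
      (algebraMap K (FreeAlgebra K (Fin 3)) α1)
  | r1 : D3Rel K α1 α2
      (ι K (2 : Fin 3) * ι K (0 : Fin 3) + ι K (1 : Fin 3) * ι K (2 : Fin 3) +
        ι K (0 : Fin 3) * ι K (1 : Fin 3))
      (algebraMap K (FreeAlgebra K (Fin 3)) α2)
  | r2 : D3Rel K α1 α2
      (ι K (2 : Fin 3) * ι K (1 : Fin 3) + ι K (1 : Fin 3) * ι K (0 : Fin 3) +
        ι K (0 : Fin 3) * ι K (2 : Fin 3))
      (algebraMap K (FreeAlgebra K (Fin 3)) α2)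

/-- The algebra `D₃(α₁, α₂)`: the quotient of the free algebra `K⟨a,b,c⟩` by the two-sided
ideal generated by the relations above. -/
abbrev D3 (K : Type) [Field K] (α1 α2 : K) : Type := RingQuot (D3Rel K α1 α2)

/-- The generator `a` of `D₃(α₁, α₂)`. -/
def D3a (K : Type) [Field K] (α1 α2 : K) : D3 K α1 α2 :=
  RingQuot.mkAlgHom K (D3Rel K α1 α2) (ι K (0 : Fin 3))

/-- The generator `b` of `D₃(α₁, α₂)`. -/
def D3b (K : Type) [Field K] (α1 α2 : K) : D3 K α1 α2 :=
  RingQuot.mkAlgHom K (D3Rel K α1 α2) (ι K (1 : Fin 3))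

/-- The generator `c` of `D₃(α₁, α₂)`. -/
def D3c (K : Type) [Field K] (α1 α2 : K) : D3 K α1 α2 :=
  RingQuot.mkAlgHom K (D3Rel K α1 α2) (ι K (2 : Fin 3))

section Relations

variable {K A : Type*} [CommRing K] [Ring A] [Algebra K A] {α β : K} {a b c x y : A}

/-- If `x² = α` and `y² = α`, then `(x + y)²` commutes with `x`. -/
theorem add_sq_commute_left (hx : x * x = α • (1 : A)) (hy : y * y = α • (1 : A)) :
    Commute ((x + y) ^ 2) x := by
  rw [commute_iff_eq]
  linear_combination (norm := skip) hy * x - x * hy + y * hx - hx * y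
  simp only [pow_two, mul_add, add_mul, mul_assoc, smul_mul_assoc, mul_smul_comm, one_mul,
    mul_one]
  module

theorem add_sq_commute_right (hx : x * x = α • (1 : A)) (hy : y * y = α • (1 : A)) :
    Commute ((x + y) ^ 2) y := by
  rw [add_comm]
  exact add_sq_commute_left hy hx

theorem add_sq_add_add_sq_add_add_sq (ha : a * a = α • (1 : A)) (hb : b * b = α • (1 : A))
    (hc : c * c = α • (1 : A)) (h₁ : c * a + b * c + a * b = β • (1 : A))
    (h₂ : c * b + b * a + a * c = β • (1 : A)) :
    (b + c) ^ 2 + (c + a) ^ 2 + (a + b) ^ 2 = (6 * α + 2 * β) • (1 : A) := by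
  linear_combination (norm := skip) (2 : K) • ha + (2 : K) • hb + (2 : K) • hc + h₁ + h₂
  simp only [pow_two, mul_add, add_mul]
  module

theorem add_sq_commute_of_relations (ha : a * a = α • (1 : A)) (hb : b * b = α • (1 : A))
    (hc : c * c = α • (1 : A)) (h₁ : c * a + b * c + a * b = β • (1 : A))
    (h₂ : c * b + b * a + a * c = β • (1 : A)) : Commute ((b + c) ^ 2) a := by
  have hsum : (b + c) ^ 2 = (6 * α + 2 * β) • (1 : A) - (c + a) ^ 2 - (a + b) ^ 2 := by
    rw [← add_sq_add_add_sq_add_add_sq ha hb hc h₁ h₂]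
    abel
  rw [hsum]
  exact (((Commute.one_left a).smul_left _).sub_left (add_sq_commute_right hc ha)).sub_left
    (add_sq_commute_left ha hb)

theorem mul_mul_eq_reverse (ha : a * a = α • (1 : A))
    (h₁ : c * a + b * c + a * b = β • (1 : A)) (h₂ : c * b + b * a + a * c = β • (1 : A)) :
    a * b * c = c * b * a := by
  linear_combination (norm := skip) a * h₁ - h₂ * a - ha * b + b * ha
  simp only [mul_add, add_mul, mul_assoc, smul_mul_assoc, mul_smul_comm, one_mul, mul_one]
  module

theorem add_sq_sub_mul_add_sq_sub (ha : a * a = α • (1 : A)) (hb : b * b = α • (1 : A))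
    (hc : c * c = α • (1 : A)) (h₁ : c * a + b * c + a * b = β • (1 : A))
    (h₂ : c * b + b * a + a * c = β • (1 : A)) :
    ((b + c) ^ 2 - (α + β) • (1 : A)) * ((c + a) ^ 2 - (α + β) • (1 : A)) = 0 := by
  have habc : a * b * c = c * b * a := mul_mul_eq_reverse ha h₁ h₂
  have hbca : b * c * a = a * c * b :=
    mul_mul_eq_reverse hb (by rw [← h₁]; abel) (by rw [← h₂]; abel)
  have hcab : c * a * b = b * a * c :=
    mul_mul_eq_reverse hc (by rw [← h₁]; abel) (by rw [← h₂]; abel)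
  have haca : a * c * a = β • a - α • b - a * b * c := by
    linear_combination (norm := skip) a * h₁ - ha * b
    simp only [mul_add, mul_assoc, smul_mul_assoc, mul_smul_comm, one_mul, mul_one]
    module
  have hcac : c * a * c = a * c * a + β • (c - a) := by
    linear_combination (norm := skip) c * h₂ - hc * b + habc - haca
    simp only [mul_add, mul_assoc, smul_mul_assoc, mul_smul_comm, one_mul, mul_one]
    module
  have hbab : b * a * b = a * b * a - β • (a - b) := by
    linear_combination (norm := skip) b * h₁ - hb * c - a * h₂ + ha * c - hbca
    simp only [mul_add, mul_assoc, smul_mul_assoc, mul_smul_comm, one_mul, mul_one]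
    module
  have hbcac : b * c * a * c = β • (a * c) - (α * α) • (1 : A) - a * b * a * c := by
    linear_combination (norm := skip) b * hcac + b * haca - α • hb - hbab * c
    simp only [mul_add, mul_sub, sub_mul, mul_assoc, smul_mul_assoc, mul_smul_comm]
    module
  have hcbca : c * b * c * a = a * b * a * c + β • (c * b - a * b) := by
    linear_combination (norm := skip) c * hbca + hcac * b + a * hcab
    simp only [add_mul, sub_mul, mul_assoc, smul_mul_assoc]
    module
  have hcbac : c * b * a * c = α • (a * b) := by
    linear_combination (norm := skip) hc * (a * b) - c * hcab
    simp only [mul_assoc, smul_mul_assoc, one_mul]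
    module
  have hbcca : b * c * c * a = α • (b * a) := by
    linear_combination (norm := skip) b * hc * a
    simp only [mul_assoc, smul_mul_assoc, mul_smul_comm, one_mul]
    module
  have hprod : (b * c + c * b) * (c * a + a * c) =
      (α - β) • (a * b + b * a) + (β * β - α * α) • (1 : A) := by
    linear_combination (norm := skip) hbcac + hcbca + hcbac + hbcca + β • h₂
    simp only [mul_add, add_mul, mul_assoc]
    module
  have hp : (b + c) ^ 2 - (α + β) • (1 : A) = b * c + c * b + (α - β) • (1 : A) := by
    linear_combination (norm := skip) hb + hc
    simp only [pow_two, mul_add, add_mul]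
    module
  have hq : (c + a) ^ 2 - (α + β) • (1 : A) = c * a + a * c + (α - β) • (1 : A) := by
    linear_combination (norm := skip) hc + ha
    simp only [pow_two, mul_add, add_mul]
    module
  rw [hp, hq]
  linear_combination (norm := skip) hprod + (α - β) • h₁ + (α - β) • h₂
  simp only [mul_add, add_mul, mul_assoc, smul_mul_assoc, mul_smul_comm, one_mul, mul_one]
  module

end Relations

theorem isIdempotentElem_of_add_add_eq_one {R : Type*} [Semiring R] {x y z : R}
    (hxy : x * y = 0) (hxz : x * z = 0) (h : x + y + z = 1) : IsIdempotentElem x := by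
  have := congrArg (x * ·) h
  simpa [mul_add, hxy, hxz, IsIdempotentElem] using this

namespace D3

variable {K : Type} [Field K] {α1 α2 : K}

theorem a_mul_a : D3a K α1 α2 * D3a K α1 α2 = α1 • 1 := by
  simpa [D3a, Algebra.algebraMap_eq_smul_one] using
    RingQuot.mkAlgHom_rel K (D3Rel.ra (α1 := α1) (α2 := α2))

theorem b_mul_b : D3b K α1 α2 * D3b K α1 α2 = α1 • 1 := by
  simpa [D3b, Algebra.algebraMap_eq_smul_one] using
    RingQuot.mkAlgHom_rel K (D3Rel.rb (α1 := α1) (α2 := α2))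

theorem c_mul_c : D3c K α1 α2 * D3c K α1 α2 = α1 • 1 := by
  simpa [D3c, Algebra.algebraMap_eq_smul_one] using
    RingQuot.mkAlgHom_rel K (D3Rel.rc (α1 := α1) (α2 := α2))

theorem ca_add_bc_add_ab :
    D3c K α1 α2 * D3a K α1 α2 + D3b K α1 α2 * D3c K α1 α2 + D3a K α1 α2 * D3b K α1 α2 =
      α2 • 1 := by
  simpa [D3a, D3b, D3c, Algebra.algebraMap_eq_smul_one] using
    RingQuot.mkAlgHom_rel K (D3Rel.r1 (α1 := α1) (α2 := α2))

theorem cb_add_ba_add_ac :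
    D3c K α1 α2 * D3b K α1 α2 + D3b K α1 α2 * D3a K α1 α2 + D3a K α1 α2 * D3c K α1 α2 =
      α2 • 1 := by
  simpa [D3a, D3b, D3c, Algebra.algebraMap_eq_smul_one] using
    RingQuot.mkAlgHom_rel K (D3Rel.r2 (α1 := α1) (α2 := α2))

/-- An element commuting with the three generators is central. -/
theorem commute_of_commute_generators {z : D3 K α1 α2} (ha : Commute z (D3a K α1 α2))
    (hb : Commute z (D3b K α1 α2)) (hc : Commute z (D3c K α1 α2)) (x : D3 K α1 α2) :
    Commute z x := by
  obtain ⟨x, rfl⟩ := RingQuot.mkAlgHom_surjective K (D3Rel K α1 α2) x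
  induction x using FreeAlgebra.induction with
  | grade0 r => rw [AlgHom.commutes]; exact Algebra.commute_algebraMap_right r z
  | grade1 i =>
    fin_cases i
    · exact ha
    · exact hb
    · exact hc
  | mul x y hx hy => rw [map_mul]; exact hx.mul_right hy
  | add x y hx hy => rw [map_add]; exact hx.add_right hy

end D3

theorem D3_idempotents (K : Type) [Field K] [IsAlgClosed K] (hchar : ringChar K ≠ 2)
    (α1 α2 : K) (h : 3 * α1 - α2 ≠ 0) :
    let a := D3a K α1 α2
    let b := D3b K α1 α2
    let c := D3c K α1 α2
    let e1 := (3 * α1 - α2)⁻¹ • ((b + c) ^ 2 - algebraMap K (D3 K α1 α2) (α1 + α2))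
    let e2 := (3 * α1 - α2)⁻¹ • ((a + c) ^ 2 - algebraMap K (D3 K α1 α2) (α1 + α2))
    let e3 := (3 * α1 - α2)⁻¹ • ((a + b) ^ 2 - algebraMap K (D3 K α1 α2) (α1 + α2))
    (IsIdempotentElem e1 ∧ IsIdempotentElem e2 ∧ IsIdempotentElem e3) ∧
    (∀ x, e1 * x = x * e1) ∧ (∀ x, e2 * x = x * e2) ∧ (∀ x, e3 * x = x * e3) ∧
    (e1 * e2 = 0 ∧ e2 * e1 = 0 ∧ e1 * e3 = 0 ∧ e3 * e1 = 0 ∧ e2 * e3 = 0 ∧ e3 * e2 = 0) ∧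
    e1 + e2 + e3 = 1 := by
  intro a b c e1 e2 e3
  have ha : a * a = α1 • 1 := D3.a_mul_a
  have hb : b * b = α1 • 1 := D3.b_mul_b
  have hc : c * c = α1 • 1 := D3.c_mul_c
  have h₁ : c * a + b * c + a * b = α2 • 1 := D3.ca_add_bc_add_ab
  have h₂ : c * b + b * a + a * c = α2 • 1 := D3.cb_add_ba_add_ac
  have h₁' : a * b + c * a + b * c = α2 • 1 := by rw [← h₁]; abel
  have h₂' : a * c + c * b + b * a = α2 • 1 := by rw [← h₂]; abel
  have h₁'' : b * c + a * b + c * a = α2 • 1 := by rw [← h₁]; abel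
  have h₂'' : b * a + a * c + c * b = α2 • 1 := by rw [← h₂]; abel
  have he1 : e1 = (3 * α1 - α2)⁻¹ • ((b + c) ^ 2 - (α1 + α2) • 1) := by
    rw [← Algebra.algebraMap_eq_smul_one]
  have he2 : e2 = (3 * α1 - α2)⁻¹ • ((c + a) ^ 2 - (α1 + α2) • 1) := by
    rw [← Algebra.algebraMap_eq_smul_one, add_comm c a]
  have he3 : e3 = (3 * α1 - α2)⁻¹ • ((a + b) ^ 2 - (α1 + α2) • 1) := by
    rw [← Algebra.algebraMap_eq_smul_one]
  have central {z : D3 K α1 α2} (hza : Commute z a) (hzb : Commute z b) (hzc : Commute z c)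
      (x : D3 K α1 α2) :
      Commute ((3 * α1 - α2)⁻¹ • (z - (α1 + α2) • (1 : D3 K α1 α2))) x :=
    ((D3.commute_of_commute_generators hza hzb hzc x).sub_left
      ((Commute.one_left x).smul_left _)).smul_left _
  have c1 (x) : Commute e1 x := he1 ▸ central (add_sq_commute_of_relations ha hb hc h₁ h₂)
    (add_sq_commute_left hb hc) (add_sq_commute_right hb hc) x
  have c2 (x) : Commute e2 x := he2 ▸ central (add_sq_commute_right hc ha)
    (add_sq_commute_of_relations hb hc ha h₁' h₂') (add_sq_commute_left hc ha) x
  have c3 (x) : Commute e3 x := he3 ▸ central (add_sq_commute_left ha hb)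
    (add_sq_commute_right ha hb) (add_sq_commute_of_relations hc ha hb h₁'' h₂'') x
  have h12 : e1 * e2 = 0 := by
    rw [he1, he2, smul_mul_smul_comm, add_sq_sub_mul_add_sq_sub ha hb hc h₁ h₂, smul_zero]
  have h23 : e2 * e3 = 0 := by
    rw [he2, he3, smul_mul_smul_comm, add_sq_sub_mul_add_sq_sub hb hc ha h₁' h₂', smul_zero]
  have h31 : e3 * e1 = 0 := by
    rw [he3, he1, smul_mul_smul_comm, add_sq_sub_mul_add_sq_sub hc ha hb h₁'' h₂'', smul_zero]
  have h21 : e2 * e1 = 0 := (c2 e1).eq.trans h12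
  have h32 : e3 * e2 = 0 := (c3 e2).eq.trans h23
  have h13 : e1 * e3 = 0 := (c1 e3).eq.trans h31
  have hsum : e1 + e2 + e3 = 1 := by
    have hs := add_sq_add_add_sq_add_add_sq ha hb hc h₁ h₂
    rw [he1, he2, he3, ← smul_add, ← smul_add, inv_smul_eq_iff₀ h]
    linear_combination (norm := module) hs
  exact ⟨⟨isIdempotentElem_of_add_add_eq_one h12 h13 hsum,
      isIdempotentElem_of_add_add_eq_one h21 h23 (by rw [← hsum]; abel),
      isIdempotentElem_of_add_add_eq_one h31 h32 (by rw [← hsum]; abel)⟩,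
    fun x ↦ (c1 x).eq, fun x ↦ (c2 x).eq, fun x ↦ (c3 x).eq,
    ⟨h12, h21, h13, h31, h23, h32⟩, hsum⟩
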